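/- Let s ≥ 5, let (hᵢ, kᵢ) ∈ ℝ² and wᵢ > 0 for i = 1,…,s, set cᵢ = (hᵢ, kᵢ, hᵢ²/2, kᵢ²/2, hᵢkᵢ), and suppose A = Σᵢ₌₁ˢ wᵢ² cᵢ cᵢᵀ is invertible. Let u : ℝ² → ℝ be a polynomial of total degree at most 2, fix (x₀, y₀) ∈ ℝ², and set U₀ = u(x₀, y₀), Uᵢ = u(x₀ + hᵢ, y₀ + kᵢ), b = Σᵢ₌₁ˢ wᵢ² (Uᵢ − U₀) cᵢ. Then the solution D = A⁻¹b equals the exact vector of derivatives (∂ₓu, ∂ᵧu, ∂ₓₓu, ∂ᵧᵧu, ∂ₓᵧu) evaluated at (x₀, y₀). -/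

import Mathlib

open Finset Matrix

/-- Partial derivative with respect to the first coordinate. -/
noncomputable def pdx (f : ℝ × ℝ → ℝ) (p : ℝ × ℝ) : ℝ :=
  deriv (fun t => f (t, p.2)) p.1

/-- Partial derivative with respect to the second coordinate. -/
noncomputable def pdy (f : ℝ × ℝ → ℝ) (p : ℝ × ℝ) : ℝ :=
  deriv (fun t => f (p.1, t)) p.2

lemma quad_form (P : MvPolynomial (Fin 2) ℝ) (hP : P.totalDegree ≤ 2) :
    ∃ a b c d e f : ℝ, ∀ x y : ℝ, MvPolynomial.eval ![x, y] P =
      a + b * x + c * y + d * x ^ 2 + e * y ^ 2 + f * (x * y) := by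
  have key : ∀ S : Finset (Fin 2 →₀ ℕ), S ⊆ P.support → ∃ a b c d e f : ℝ, ∀ x y : ℝ,
      ∑ m ∈ S, P.coeff m * (x ^ m 0 * y ^ m 1) =
      a + b * x + c * y + d * x ^ 2 + e * y ^ 2 + f * (x * y) := by
    intro S
    induction S using Finset.induction_on with
    | empty => intro _; exact ⟨0, 0, 0, 0, 0, 0, by simp⟩
    | insert m S hm ih =>
      intro hS
      obtain ⟨a, b, c, d, e, f, H⟩ := ih (fun z hz => hS (Finset.mem_insert_of_mem hz))
      have hdeg := (MvPolynomial.le_totalDegree (hS (Finset.mem_insert_self m S))).trans hP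
      rw [Finsupp.sum_fintype _ _ (fun _ => rfl), Fin.sum_univ_two] at hdeg
      simp only [Finset.sum_insert hm, H]
      generalize P.coeff m = q
      generalize m 0 = i at *
      generalize m 1 = j at *
      have hi : i ≤ 2 := by omega
      have hj : j ≤ 2 := by omega
      interval_cases i <;> interval_cases j <;> try omega
      · exact ⟨a + q, b, c, d, e, f, fun x y => by ring⟩
      · exact ⟨a, b, c + q, d, e, f, fun x y => by ring⟩
      · exact ⟨a, b, c, d, e + q, f, fun x y => by ring⟩
      · exact ⟨a, b + q, c, d, e, f, fun x y => by ring⟩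
      · exact ⟨a, b, c, d, e, f + q, fun x y => by ring⟩
      · exact ⟨a, b, c, d + q, e, f, fun x y => by ring⟩
  obtain ⟨a, b, c, d, e, f, H⟩ := key P.support (Finset.Subset.refl _)
  refine ⟨a, b, c, d, e, f, fun x y => ?_⟩
  rw [← H, MvPolynomial.eval_eq']
  simp [Fin.prod_univ_two]

lemma deriv_quad (a b c t : ℝ) : deriv (fun t : ℝ => a + b * t + c * t ^ 2) t = b + 2 * c * t := by
  have h := (((hasDerivAt_id t).const_mul b).const_add a).add (((hasDerivAt_id t).pow 2).const_mul c)
  have h2 : HasDerivAt (fun t : ℝ => a + b * t + c * t ^ 2) (b + 2 * c * t) t := by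
    refine HasDerivAt.congr_deriv h ?_
    simp
    ring
  exact h2.deriv

/-- The GFD derivative approximations are exact on polynomials of total degree at most 2:
the solution D = A⁻¹b of the normal equations equals the exact vector of first- and
second-order partial derivatives of u at the central node (x₀, y₀). -/
theorem GFD_exact_on_quadratics
    (s : ℕ) (hs : 5 ≤ s)
    (h k : Fin s → ℝ) (w : Fin s → ℝ) (hw : ∀ i, 0 < w i)
    (c : Fin s → Fin 5 → ℝ)
    (hc : ∀ i, c i = ![h i, k i, h i ^ 2 / 2, k i ^ 2 / 2, h i * k i])
    (A : Matrix (Fin 5) (Fin 5) ℝ)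
    (hA : A = ∑ i, (w i ^ 2) • Matrix.vecMulVec (c i) (c i))
    (hAdet : IsUnit A.det)
    (P : MvPolynomial (Fin 2) ℝ) (hP : P.totalDegree ≤ 2)
    (u : ℝ × ℝ → ℝ) (hu : ∀ p : ℝ × ℝ, u p = MvPolynomial.eval ![p.1, p.2] P)
    (x0 y0 : ℝ)
    (U0 : ℝ) (hU0 : U0 = u (x0, y0))
    (U : Fin s → ℝ) (hU : ∀ i, U i = u (x0 + h i, y0 + k i))
    (b : Fin 5 → ℝ) (hb : b = ∑ i, (w i ^ 2 * (U i - U0)) • c i) :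
    A⁻¹ *ᵥ b =
      ![pdx u (x0, y0), pdy u (x0, y0),
        pdx (pdx u) (x0, y0), pdy (pdy u) (x0, y0), pdy (pdx u) (x0, y0)] := by
  obtain ⟨a0, a1, a2, a3, a4, a5, H⟩ := quad_form P hP
  have hu' : u = fun p : ℝ × ℝ =>
      a0 + a1 * p.1 + a2 * p.2 + a3 * p.1 ^ 2 + a4 * p.2 ^ 2 + a5 * (p.1 * p.2) := by
    funext p; rw [hu, H]
  have hx : pdx u = fun p : ℝ × ℝ => a1 + 2 * a3 * p.1 + a5 * p.2 := by
    funext p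
    rw [hu']
    have := deriv_quad (a0 + a2 * p.2 + a4 * p.2 ^ 2) (a1 + a5 * p.2) a3 p.1
    unfold pdx
    convert this using 1
    · congr 1; funext t; ring
    · ring
  have hy : pdy u = fun p : ℝ × ℝ => a2 + 2 * a4 * p.2 + a5 * p.1 := by
    funext p
    rw [hu']
    have := deriv_quad (a0 + a1 * p.1 + a3 * p.1 ^ 2) (a2 + a5 * p.1) a4 p.2
    unfold pdy
    convert this using 1
    · congr 1; funext t; ring
    · ring
  have hxx : pdx (pdx u) (x0, y0) = 2 * a3 := by
    rw [hx]
    have := deriv_quad (a1 + a5 * y0) (2 * a3) 0 x0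
    unfold pdx
    convert this using 1
    · congr 1; funext t; ring
    · ring
  have hyy : pdy (pdy u) (x0, y0) = 2 * a4 := by
    rw [hy]
    have := deriv_quad (a2 + a5 * x0) (2 * a4) 0 y0
    unfold pdy
    convert this using 1
    · congr 1; funext t; ring
    · ring
  have hxy : pdy (pdx u) (x0, y0) = a5 := by
    rw [hx]
    have := deriv_quad (a1 + 2 * a3 * x0) a5 0 y0
    unfold pdy
    convert this using 1
    · congr 1; funext t; ring
    · ring
  rw [hxx, hyy, hxy, hx, hy]
  have hbA : b = A *ᵥ ![a1 + 2 * a3 * x0 + a5 * y0, a2 + 2 * a4 * y0 + a5 * x0,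
      2 * a3, 2 * a4, a5] := by
    rw [hb, hA, Matrix.sum_mulVec]
    refine Finset.sum_congr rfl fun i _ => ?_
    rw [Matrix.smul_mulVec, Matrix.vecMulVec_mulVec, mul_smul]
    congr 1
    have e : U i - U0 = c i ⬝ᵥ ![a1 + 2 * a3 * x0 + a5 * y0, a2 + 2 * a4 * y0 + a5 * x0,
      2 * a3, 2 * a4, a5] := by
      rw [hU, hU0, hu', hc]
      simp [dotProduct, Fin.sum_univ_five]
      ring
    rw [e, op_smul_eq_smul]
  rw [hbA, Matrix.mulVec_mulVec, Matrix.nonsing_inv_mul A hAdet, Matrix.one_mulVec]
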